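/- Let k ≥ 2 and n ≥ k⁴. Then every (n−2k+1)-coloring of the (n,k)-Kneser graph has at least one star-shaped color class. -/

import Mathlib

/-- The number of `k`-sets containing two given distinct points. -/
theorem card_pair_le (n k : ℕ) (i j : Fin n) (hij : i ≠ j) :
    (((Finset.univ : Finset (Fin n)).powersetCard k).filter
      (fun U => i ∈ U ∧ j ∈ U)).card ≤ (n - 2).choose (k - 2) := by
  classical
  have h2 : ({i, j} : Finset (Fin n)).card = 2 := Finset.card_pair hij
  have hc : ((Finset.univ \ {i, j} : Finset (Fin n)).powersetCard (k - 2)).card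
      = (n - 2).choose (k - 2) := by
    rw [Finset.card_powersetCard, Finset.card_sdiff_of_subset (Finset.subset_univ _), h2,
      Finset.card_univ, Fintype.card_fin]
  rw [← hc]
  apply Finset.card_le_card_of_injOn (fun U => U \ {i, j})
  · intro U hU
    simp only [Finset.coe_filter, Finset.mem_powersetCard, Set.mem_setOf_eq] at hU
    obtain ⟨⟨_, hk⟩, hi, hj⟩ := hU
    have hsub : ({i, j} : Finset (Fin n)) ⊆ U := by
      intro x hx
      simp only [Finset.mem_insert, Finset.mem_singleton] at hx
      rcases hx with rfl | rfl <;> assumption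
    simp only [Finset.mem_coe, Finset.mem_powersetCard]
    refine ⟨Finset.sdiff_subset_sdiff (Finset.subset_univ _) (Finset.Subset.refl _), ?_⟩
    rw [Finset.card_sdiff_of_subset hsub, h2, hk]
  · intro U hU V hV h
    simp only [Finset.coe_filter, Set.mem_setOf_eq] at hU hV
    ext x
    have hx := congrArg (fun W => x ∈ W) h
    simp only [Finset.mem_sdiff, Finset.mem_insert, Finset.mem_singleton, eq_iff_iff] at hx
    by_cases h1 : x = i
    · subst h1; exact iff_of_true hU.2.1 hV.2.1
    by_cases h3 : x = j
    · subst h3; exact iff_of_true hU.2.2 hV.2.2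
    simpa [h1, h3] using hx

/-- For `k ≥ 2` and `n ≥ k⁴`, every `(n-2k+1)`-coloring of the `(n,k)`-Kneser graph
has at least one star-shaped color class, i.e. a color `ℓ` such that some node `i`
belongs to every `k`-subset colored `ℓ`. -/
theorem exists_starShaped_class (n k : ℕ) (hk : 2 ≤ k) (hn : k ^ 4 ≤ n)
    (c : Finset (Fin n) → ℕ)
    (hrange : ∀ S : Finset (Fin n), S.card = k → c S ∈ Finset.Icc 1 (n - 2 * k + 1))
    (hproper : ∀ S T : Finset (Fin n), S.card = k → T.card = k →
      Disjoint S T → c S ≠ c T) :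
    ∃ ℓ ∈ Finset.Icc 1 (n - 2 * k + 1), ∃ i : Fin n,
      ∀ S : Finset (Fin n), S.card = k → c S = ℓ → i ∈ S := by
  classical
  by_contra! hcon
  have h8 : 8 * k ≤ n := by
    have : 2 ^ 3 ≤ k ^ 3 := Nat.pow_le_pow_left hk 3
    calc 8 * k ≤ k ^ 3 * k := Nat.mul_le_mul_right k this
      _ = k ^ 4 := by ring
      _ ≤ n := hn
  have hclass : ∀ ℓ ∈ Finset.Icc 1 (n - 2 * k + 1),
      (((Finset.univ : Finset (Fin n)).powersetCard k).filter (fun U => c U = ℓ)).card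
        ≤ k * (k * (n - 2).choose (k - 2)) := by
    intro ℓ hℓ
    have hT := hcon ℓ hℓ
    choose T hTk hTc hTi using hT
    let S := T ⟨0, by omega⟩
    have hSk : S.card = k := hTk _
    have hSc : c S = ℓ := hTc _
    have hsub : ((Finset.univ : Finset (Fin n)).powersetCard k).filter (fun U => c U = ℓ) ⊆
        S.biUnion (fun i => (T i).biUnion (fun j =>
          ((Finset.univ : Finset (Fin n)).powersetCard k).filter
            (fun U => i ∈ U ∧ j ∈ U))) := by
      intro U hU
      simp only [Finset.mem_filter, Finset.mem_powersetCard] at hU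
      obtain ⟨⟨hU1, hUk⟩, hUc⟩ := hU
      have meet : ∀ V : Finset (Fin n), V.card = k → c V = ℓ → ∃ x ∈ V, x ∈ U := by
        intro V hVk hVc
        by_contra! h
        exact hproper V U hVk hUk (Finset.disjoint_left.2 h) (hVc.trans hUc.symm)
      obtain ⟨i, hi, hiU⟩ := meet S hSk hSc
      obtain ⟨j, hj, hjU⟩ := meet (T i) (hTk i) (hTc i)
      simp only [Finset.mem_biUnion, Finset.mem_filter, Finset.mem_powersetCard]
      exact ⟨i, hi, j, hj, ⟨hU1, hUk⟩, hiU, hjU⟩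
    refine (Finset.card_le_card hsub).trans ?_
    have h1 := Finset.card_biUnion_le_card_mul S (fun i => (T i).biUnion (fun j =>
          ((Finset.univ : Finset (Fin n)).powersetCard k).filter
            (fun U => i ∈ U ∧ j ∈ U))) (k * (n - 2).choose (k - 2)) (by
      intro i _
      have h2 := Finset.card_biUnion_le_card_mul (T i) (fun j =>
          ((Finset.univ : Finset (Fin n)).powersetCard k).filter
            (fun U => i ∈ U ∧ j ∈ U)) ((n - 2).choose (k - 2)) (by
        intro j hj
        apply card_pair_le
        rintro rfl
        exact hTi _ hj)
      rwa [hTk i] at h2)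
    rwa [hSk] at h1
  have htot : n.choose k ≤ (n - 2 * k + 1) * (k * (k * (n - 2).choose (k - 2))) := by
    have h := Finset.card_eq_sum_card_fiberwise (f := c)
      (s := (Finset.univ : Finset (Fin n)).powersetCard k)
      (t := Finset.Icc 1 (n - 2 * k + 1)) (by
        intro S hS
        exact hrange S (Finset.mem_powersetCard.1 hS).2)
    rw [Finset.card_powersetCard, Finset.card_univ, Fintype.card_fin] at h
    rw [h]
    refine (Finset.sum_le_card_nsmul _ _ _ hclass).trans ?_
    simp
  obtain ⟨r, rfl⟩ : ∃ r, k = r + 2 := ⟨k - 2, by omega⟩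
  obtain ⟨m, rfl⟩ : ∃ m, n = m + 2 := ⟨n - 2, by omega⟩
  have e1 := Nat.add_one_mul_choose_eq m r
  have e2 := Nat.add_one_mul_choose_eq (m + 1) (r + 1)
  have hpos : 0 < m.choose r := Nat.choose_pos (by omega)
  have hle : m + 2 - 2 * (r + 2) + 1 ≤ m + 1 := by omega
  simp only [Nat.add_sub_cancel] at htot
  set C := m.choose r
  have hA : (m + 2) * (m + 1) * C = (m + 2).choose (r + 2) * ((r + 2) * (r + 1)) := by
    have : (m + 2) * (m + 1) * C = (m + 2) * ((m + 1) * C) := by ring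
    rw [this, e1]
    have : (m + 2) * ((m + 1).choose (r + 1) * (r + 1))
      = ((m + 2) * (m + 1).choose (r + 1)) * (r + 1) := by ring
    rw [this]
    have e2' : (m + 2) * (m + 1).choose (r + 1) = (m + 2).choose (r + 2) * (r + 2) := e2
    rw [e2']; ring
  have hB : (m + 2) * (m + 1) * C
      ≤ (m + 1) * ((r + 2) * ((r + 2) * C)) * ((r + 2) * (r + 1)) := by
    rw [hA]
    exact Nat.mul_le_mul_right _ (htot.trans (Nat.mul_le_mul_right _ hle))
  have hB' : (m + 2) * ((m + 1) * C) ≤ ((r + 2) ^ 3 * (r + 1)) * ((m + 1) * C) := by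
    calc _ = (m + 2) * (m + 1) * C := by ring
      _ ≤ _ := hB
      _ = _ := by ring
  have h3 := Nat.le_of_mul_le_mul_right hB' (by positivity)
  have h4 : (r + 2) ^ 4 = (r + 2) ^ 3 * (r + 1) + (r + 2) ^ 3 := by ring
  have h5 : 0 < (r + 2) ^ 3 := by positivity
  omega
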